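/- Let F be the free Lie algebra on a finite set over a field P, and let ξ be an automorphism of the monoid End(F) such that ξ(g) = g for all linear automorphisms g of F. If ξ(c_p) = c_q and x is a generator occurring in the basis expansion of p but not of q (or vice versa), and P contains an element a of infinite multiplicative order, then a contradiction arises; hence p and q involve exactly the same set of generators. -/

import Mathlib

namespace FreeLieAlgebra

theorem induction_of {R X : Type*} [CommRing R] (S : LieSubalgebra R (FreeLieAlgebra R X))
    (hS : ∀ y, of R y ∈ S) (f : FreeLieAlgebra R X) : f ∈ S := by
  have h : S.incl.comp (lift R fun y => (⟨of R y, hS y⟩ : S)) = LieHom.id := by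
    ext y
    simp
  have hf := LieHom.congr_fun h f
  simp only [LieHom.comp_apply, LieHom.id_apply] at hf
  rw [← hf]
  exact Subtype.property _

section Scale

variable {P X : Type*} [Field P]

open Classical in
/-- The endomorphism multiplying the generator `x` by `b` and fixing the other generators. -/
noncomputable def scale (x : X) (b : P) : FreeLieAlgebra P X →ₗ⁅P⁆ FreeLieAlgebra P X :=
  lift P fun y => (if y = x then b else 1) • of P y

theorem scale_of_self (x : X) (b : P) : scale x b (of P x) = b • of P x := by
  simp [scale]

theorem scale_of_ne {x y : X} (h : y ≠ x) (b : P) : scale x b (of P y) = of P y := by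
  simp [scale, h]

theorem scale_scale_inv (x : X) {b : P} (hb : b ≠ 0) (f : FreeLieAlgebra P X) :
    scale x b (scale x b⁻¹ f) = f := by
  have h : (scale x b).comp (scale x b⁻¹) = LieHom.id := by
    ext y
    by_cases hy : y = x
    · subst hy
      simp [scale_of_self, smul_smul, hb]
    · simp [scale_of_ne hy]
  exact LieHom.congr_fun h f

theorem scale_bijective (x : X) {b : P} (hb : b ≠ 0) : Function.Bijective (scale x b) := by
  refine Function.bijective_iff_has_inverse.mpr ⟨scale x b⁻¹, fun f => ?_, scale_scale_inv x hb⟩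
  simpa using scale_scale_inv x (inv_ne_zero hb) f

theorem scale_of_mem_span (x : X) (b : P) (y : X) :
    scale x b (of P y) ∈ Submodule.span P (Set.range (of P : X → FreeLieAlgebra P X)) := by
  by_cases hy : y = x
  · subst hy
    rw [scale_of_self]
    exact Submodule.smul_mem _ _ (Submodule.subset_span ⟨y, rfl⟩)
  · rw [scale_of_ne hy]
    exact Submodule.subset_span ⟨y, rfl⟩

theorem scale_eq_self_of_mem {x : X} {f : FreeLieAlgebra P X}
    (hf : f ∈ LieSubalgebra.lieSpan P (FreeLieAlgebra P X) (of P '' {y : X | y ≠ x})) (b : P) :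
    scale x b f = f := by
  induction hf using LieSubalgebra.lieSpan_induction with
  | mem f hf =>
    obtain ⟨y, hy, rfl⟩ := hf
    exact scale_of_ne hy b
  | zero => simp
  | add f g _ _ hf hg => simp [hf, hg]
  | smul r f _ hf => simp [hf]
  | lie f g _ _ hf hg => simp [hf, hg]

theorem scale_zero_mem (x : X) (f : FreeLieAlgebra P X) :
    scale x 0 f ∈ LieSubalgebra.lieSpan P (FreeLieAlgebra P X) (of P '' {y : X | y ≠ x}) := by
  refine induction_of ((LieSubalgebra.lieSpan P (FreeLieAlgebra P X)
    (of P '' {y : X | y ≠ x})).comap (scale x (0 : P))) (fun y => ?_) f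
  rw [LieSubalgebra.mem_comap]
  by_cases hy : y = x
  · subst hy
    rw [scale_of_self, zero_smul]
    exact zero_mem _
  · rw [scale_of_ne hy]
    exact LieSubalgebra.subset_lieSpan ⟨y, hy, rfl⟩

/-- Functions `P → L` that are polynomial, with coefficients in `L`. -/
def polynomialMaps (P L : Type*) [Field P] [LieRing L] [LieAlgebra P L] : Submodule P (P → L) :=
  Submodule.span P (Set.range fun (c : ℕ × L) (b : P) => b ^ c.1 • c.2)

theorem lie_mem_polynomialMaps {L : Type*} [LieRing L] [LieAlgebra P L] {u v : P → L}
    (hu : u ∈ polynomialMaps P L) (hv : v ∈ polynomialMaps P L) :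
    (fun b => ⁅u b, v b⁆) ∈ polynomialMaps P L := by
  unfold polynomialMaps at *
  induction hu, hv using Submodule.span_induction₂ with
  | mem_mem u v hu hv =>
    obtain ⟨c, rfl⟩ := hu
    obtain ⟨d, rfl⟩ := hv
    refine Submodule.subset_span ⟨(c.1 + d.1, ⁅c.2, d.2⁆), ?_⟩
    funext b
    simp [smul_smul, pow_add, mul_comm]
  | zero_left v _ =>
    simp only [Pi.zero_apply, zero_lie]
    exact Submodule.zero_mem _
  | zero_right u _ =>
    simp only [Pi.zero_apply, lie_zero]
    exact Submodule.zero_mem _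
  | add_left u u' v _ _ _ h h' =>
    simp only [Pi.add_apply, add_lie]
    exact Submodule.add_mem _ h h'
  | add_right u v v' _ _ _ h h' =>
    simp only [Pi.add_apply, lie_add]
    exact Submodule.add_mem _ h h'
  | smul_left r u v _ _ h =>
    simp only [Pi.smul_apply, smul_lie]
    exact Submodule.smul_mem _ r h
  | smul_right r u v _ _ h =>
    simp only [Pi.smul_apply, lie_smul]
    exact Submodule.smul_mem _ r h

theorem scale_mem_polynomialMaps (x : X) (f : FreeLieAlgebra P X) :
    (fun b => scale x b f) ∈ polynomialMaps P (FreeLieAlgebra P X) := by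
  let S : LieSubalgebra P (FreeLieAlgebra P X) :=
    { carrier := {f | (fun b => scale x b f) ∈ polynomialMaps P (FreeLieAlgebra P X)}
      zero_mem' := by
        simp only [Set.mem_ofPred_eq, map_zero]
        exact Submodule.zero_mem _
      add_mem' := fun hf hg => by
        simp only [Set.mem_ofPred_eq, map_add]
        exact Submodule.add_mem _ hf hg
      smul_mem' := fun r f hf => by
        simp only [Set.mem_ofPred_eq, map_smul]
        exact Submodule.smul_mem _ r hf
      lie_mem' := fun hf hg => by simpa using lie_mem_polynomialMaps hf hg }
  refine induction_of S (fun y => ?_) f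
  change (fun b => scale x b (of P y)) ∈ polynomialMaps P (FreeLieAlgebra P X)
  by_cases hy : y = x
  · subst hy
    exact Submodule.subset_span ⟨(1, of P y), by funext b; simp [scale_of_self]⟩
  · exact Submodule.subset_span ⟨(0, of P y), by funext b; simp [scale_of_ne hy]⟩

theorem exists_polynomial_of_mem_polynomialMaps {L : Type*} [LieRing L] [LieAlgebra P L]
    {u : P → L} (hu : u ∈ polynomialMaps P L) (φ : Module.Dual P L) :
    ∃ R : Polynomial P, ∀ b, R.eval b = φ (u b) := by
  unfold polynomialMaps at hu
  induction hu using Submodule.span_induction with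
  | mem u hu =>
    obtain ⟨c, rfl⟩ := hu
    exact ⟨Polynomial.monomial c.1 (φ c.2), fun b => by simp [mul_comm]⟩
  | zero => exact ⟨0, by simp⟩
  | add u v _ _ hu hv =>
    obtain ⟨R, hR⟩ := hu
    obtain ⟨T, hT⟩ := hv
    exact ⟨R + T, by simp [hR, hT]⟩
  | smul r u _ hu =>
    obtain ⟨R, hR⟩ := hu
    exact ⟨r • R, by simp [hR]⟩

theorem mem_of_forall_scale_eq_self [Infinite P] {x : X} {f : FreeLieAlgebra P X}
    (hf : ∀ b : P, b ≠ 0 → scale x b f = f) :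
    f ∈ LieSubalgebra.lieSpan P (FreeLieAlgebra P X) (of P '' {y : X | y ≠ x}) := by
  have h : scale x 0 f = f := by
    rw [← sub_eq_zero, ← Module.forall_dual_apply_eq_zero_iff P]
    intro φ
    obtain ⟨R, hR⟩ := exists_polynomial_of_mem_polynomialMaps (scale_mem_polynomialMaps x f) φ
    have hRC : R = Polynomial.C (φ f) := by
      refine Polynomial.eq_of_infinite_eval_eq _ _
        ((Set.finite_singleton (0 : P)).infinite_compl.mono fun b hb => ?_)
      simp [hR, hf b hb]
    rw [map_sub, ← hR, hRC, Polynomial.eval_C, sub_self]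
  rw [← h]
  exact scale_zero_mem x f

end Scale

theorem mem_lieSpan_of_map_const {P X : Type*} [Field P] [Infinite P]
    (ξ : (FreeLieAlgebra P X →ₗ⁅P⁆ FreeLieAlgebra P X) →
      (FreeLieAlgebra P X →ₗ⁅P⁆ FreeLieAlgebra P X))
    (hmul : ∀ f g, ξ (f.comp g) = (ξ f).comp (ξ g))
    (hlin : ∀ g : FreeLieAlgebra P X →ₗ⁅P⁆ FreeLieAlgebra P X, Function.Bijective g →
      (∀ x : X, g (of P x) ∈ Submodule.span P (Set.range (of P : X → FreeLieAlgebra P X))) →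
      ξ g = g)
    {p q : FreeLieAlgebra P X} (hpq : ξ (lift P fun _ : X => p) = lift P fun _ : X => q) {x : X}
    (hp : p ∈ LieSubalgebra.lieSpan P (FreeLieAlgebra P X) (of P '' {y : X | y ≠ x})) :
    q ∈ LieSubalgebra.lieSpan P (FreeLieAlgebra P X) (of P '' {y : X | y ≠ x}) := by
  refine mem_of_forall_scale_eq_self fun b hb => ?_
  have hc : (scale x b).comp (lift P fun _ : X => p) = lift P fun _ : X => p := by
    ext y
    simp [scale_eq_self_of_mem hp]
  have h := hmul (scale x b) (lift P fun _ : X => p)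
  rw [hc, hpq, hlin _ (scale_bijective x hb) (scale_of_mem_span x b)] at h
  simpa using (LieHom.congr_fun h (of P x)).symm

end FreeLieAlgebra


/-- let ξ be a multiplication-preserving bijection of End(F(X)) fixing all
linear automorphisms, with ξ(c_p) = c_q, over an infinite field containing an element a
of infinite multiplicative order. Then p and q involve exactly the same set of
generators (a generator occurs in p iff p does not lie in the Lie subalgebra generated
by the other generators). -/
theorem linearly_stable_preserves_support
    (P : Type*) [Field P] [Infinite P] (X : Type*) [Fintype X]
    (a : P) (ha : ∀ n : ℕ, 0 < n → a ^ n ≠ 1)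
    (ξ : (FreeLieAlgebra P X →ₗ⁅P⁆ FreeLieAlgebra P X) ≃
          (FreeLieAlgebra P X →ₗ⁅P⁆ FreeLieAlgebra P X))
    (hmul : ∀ f g : FreeLieAlgebra P X →ₗ⁅P⁆ FreeLieAlgebra P X,
        ξ (f.comp g) = (ξ f).comp (ξ g))
    (hlin : ∀ g : FreeLieAlgebra P X →ₗ⁅P⁆ FreeLieAlgebra P X,
        Function.Bijective g →
        (∀ x : X, g (FreeLieAlgebra.of P x) ∈
            Submodule.span P (Set.range (FreeLieAlgebra.of P : X → FreeLieAlgebra P X))) →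
        ξ g = g)
    (p q : FreeLieAlgebra P X)
    (hpq : ξ ((FreeLieAlgebra.lift P) fun _ : X => p) =
        (FreeLieAlgebra.lift P) fun _ : X => q) :
    {x : X | p ∉ LieSubalgebra.lieSpan P (FreeLieAlgebra P X)
        (FreeLieAlgebra.of P '' {y : X | y ≠ x})} =
      {x : X | q ∉ LieSubalgebra.lieSpan P (FreeLieAlgebra P X)
        (FreeLieAlgebra.of P '' {y : X | y ≠ x})} := by
  have hmul' : ∀ f g, ξ.symm (f.comp g) = (ξ.symm f).comp (ξ.symm g) := fun f g => by
    rw [ξ.symm_apply_eq, hmul, ξ.apply_symm_apply, ξ.apply_symm_apply]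
  ext x
  exact not_congr ⟨FreeLieAlgebra.mem_lieSpan_of_map_const ξ hmul hlin hpq,
    FreeLieAlgebra.mem_lieSpan_of_map_const ξ.symm hmul'
      (fun g hg hs => by rw [ξ.symm_apply_eq, hlin g hg hs])
      (by rw [ξ.symm_apply_eq, hpq])⟩
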